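/- Let T be a finite rooted tree on n ≥ 1 vertices with root r. Define an increasing sequence of sets of vertices by M₀ = ∅ and M_{i+1} = M_i ∪ {v : the set sub(v) \ M_i is a chain under the descendant relation}. Then: (a) for every i ≥ 0, every vertex v with |sub(v)| < 2^i belongs to M_i; and (b) M_L equals the whole vertex set of T for L = ⌈log₂ n⌉ + 1. -/

import Mathlib

/-- In a rooted graph `(G, r)`, `v` is a descendant of `u` if `u` lies on every path
from the root `r` to `v` (for a tree, this says `u` lies on the unique such path). -/
def IsDesc {V : Type*} (G : SimpleGraph V) (r u v : V) : Prop :=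
  ∀ p : G.Walk r v, p.IsPath → u ∈ p.support

/-- The subtree of `u` in the rooted graph `(G, r)`: the set of descendants of `u`. -/
def subtreeOf {V : Type*} (G : SimpleGraph V) (r u : V) : Set V :=
  {v | IsDesc G r u v}

/-- The increasing sequence of vertex sets: `M 0 = ∅` and `M (i+1)` adds to `M i` all
vertices `v` such that `sub(v) \ M i` is a chain under the descendant relation. -/
def Mseq {V : Type*} (G : SimpleGraph V) (r : V) : ℕ → Set V
  | 0 => ∅
  | (i + 1) => Mseq G r i ∪
      {v | (subtreeOf G r v \ Mseq G r i).Pairwise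
          fun a b => IsDesc G r a b ∨ IsDesc G r b a}

theorem aux_refl {V : Type*} (G : SimpleGraph V) (r v : V) : IsDesc G r v v :=
  fun p _ => p.end_mem_support

theorem aux_trans {V : Type*} {G : SimpleGraph V} {r u v w : V}
    (h1 : IsDesc G r u v) (h2 : IsDesc G r v w) : IsDesc G r u w := by
  classical
  intro p hp
  have hv := h2 p hp
  exact p.support_takeUntil_subset_support hv (h1 _ (hp.takeUntil hv))

theorem aux_of_path {V : Type*} {G : SimpleGraph V} (hT : G.IsTree) {r a b : V}
    (q : G.Walk r b) (hq : q.IsPath) (ha : a ∈ q.support) : IsDesc G r a b := by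
  intro p hp
  have := hT.existsUnique_path r b |>.unique hp hq
  rw [this]; exact ha

theorem aux_comp {V : Type*} {G : SimpleGraph V} (hT : G.IsTree) {r a b c : V}
    (h1 : IsDesc G r a c) (h2 : IsDesc G r b c) : IsDesc G r a b ∨ IsDesc G r b a := by
  classical
  obtain ⟨p, hp, -⟩ := hT.existsUnique_path r c
  have ha := h1 p hp
  have hb := h2 p hp
  rw [← p.take_spec ha, SimpleGraph.Walk.mem_support_append_iff] at hb
  rcases hb with hb | hb
  · exact Or.inr (aux_of_path hT _ (hp.takeUntil ha) hb)
  · left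
    refine aux_of_path hT ((p.takeUntil a ha).append ((p.dropUntil a ha).takeUntil b hb)) ?_ ?_
    · apply SimpleGraph.Walk.IsPath.of_append_left (q := (p.dropUntil a ha).dropUntil b hb)
      rw [← SimpleGraph.Walk.append_assoc, SimpleGraph.Walk.take_spec, SimpleGraph.Walk.take_spec]
      exact hp
    · rw [SimpleGraph.Walk.mem_support_append_iff]
      exact Or.inl (SimpleGraph.Walk.end_mem_support _)

/-- For a finite rooted tree on `n ≥ 1` vertices: (a) every vertex `v` with
`|sub(v)| < 2^i` belongs to `M i`; and (b) `M L` is the whole vertex set for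
`L = ⌈log₂ n⌉ + 1`. -/
theorem Mseq_covers {V : Type*} [Fintype V] (G : SimpleGraph V) (hT : G.IsTree) (r : V)
    (hn : 1 ≤ Fintype.card V) :
    (∀ (i : ℕ) (v : V), (subtreeOf G r v).ncard < 2 ^ i → v ∈ Mseq G r i) ∧
      Mseq G r (Nat.clog 2 (Fintype.card V) + 1) = Set.univ := by
  have key : ∀ (i : ℕ) (v : V), (subtreeOf G r v).ncard < 2 ^ i → v ∈ Mseq G r i := by
    intro i
    induction i with
    | zero =>
      intro v hv
      have : 0 < (subtreeOf G r v).ncard :=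
        (Set.ncard_pos (Set.toFinite _)).2 ⟨v, aux_refl G r v⟩
      simp at hv
      omega
    | succ i ih =>
      intro v hv
      refine Or.inr ?_
      rintro a ⟨ha, ha'⟩ b ⟨hb, hb'⟩ -
      by_contra hcon
      have h1 : 2 ^ i ≤ (subtreeOf G r a).ncard := not_lt.1 fun h => ha' (ih a h)
      have h2 : 2 ^ i ≤ (subtreeOf G r b).ncard := not_lt.1 fun h => hb' (ih b h)
      have hd : Disjoint (subtreeOf G r a) (subtreeOf G r b) :=
        Set.disjoint_left.2 fun c hc hc' => hcon (aux_comp hT hc hc')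
      have hu := Set.ncard_union_eq hd (Set.toFinite _) (Set.toFinite _)
      have hs : subtreeOf G r a ∪ subtreeOf G r b ⊆ subtreeOf G r v :=
        Set.union_subset (fun c hc => aux_trans ha hc) (fun c hc => aux_trans hb hc)
      have := Set.ncard_le_ncard hs (Set.toFinite _)
      rw [pow_succ] at hv
      omega
  refine ⟨key, Set.eq_univ_of_forall fun v => key _ v ?_⟩
  have h1 : (subtreeOf G r v).ncard ≤ Fintype.card V := by
    rw [← Nat.card_eq_fintype_card, ← Set.ncard_univ]
    exact Set.ncard_le_ncard (Set.subset_univ _) (Set.toFinite _)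
  have h2 := Nat.le_pow_clog (b := 2) (by norm_num) (Fintype.card V)
  rw [pow_succ]
  omega
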